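/- Let a be a fixed complex number. There exists T₁ > 0 such that for every T₀ ≥ T₁ there is a T ∈ [T₀, T₀ + 1) with the property that |T − γ_a| ≥ 1/log T for every nontrivial a-value ρ_a = β_a + iγ_a of ζ. -/

import Mathlib

open Complex

/-- The weight `exp ((z - iT)²)` localises a function on a vertical line near height `T`. -/
lemma norm_exp_sub_mul_I_sq (z : ℂ) (T : ℝ) :
    ‖exp ((z - T * I) ^ 2)‖ = Real.exp (z.re ^ 2 - (z.im - T) ^ 2) := by
  rw [norm_exp]
  congr 1
  simp [pow_two]

/-- Polynomial growth is absorbed by a Gaussian centred at height `T`, at the cost of a factor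
of the same polynomial order in `T`. -/
lemma exists_rpow_mul_exp_neg_sq_le {p : ℝ} (hp : 0 ≤ p) :
    ∃ K : ℝ, 0 < K ∧ ∀ t T : ℝ,
      (1 + |t|) ^ p * Real.exp (-(t - T) ^ 2) ≤ K * (1 + |T|) ^ p := by
  refine ⟨Real.exp (p ^ 2), Real.exp_pos _, fun t T ↦ ?_⟩
  have h1 : 1 + |t| ≤ (1 + |T|) * (1 + |t - T|) := by
    have := abs_add_le T (t - T)
    rw [add_sub_cancel] at this
    nlinarith [abs_nonneg T, abs_nonneg (t - T)]
  have h2 : (1 + |t - T|) ^ p ≤ Real.exp (p * |t - T|) := by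
    rw [mul_comm, Real.exp_mul]
    refine Real.rpow_le_rpow (by positivity) ?_ hp
    linarith [Real.add_one_le_exp |t - T|]
  have h3 : p * |t - T| + -(t - T) ^ 2 ≤ p ^ 2 := by
    rw [← sq_abs (t - T)]
    nlinarith [sq_nonneg (p - |t - T|), abs_nonneg (t - T), sq_nonneg p]
  calc (1 + |t|) ^ p * Real.exp (-(t - T) ^ 2)
      ≤ ((1 + |T|) * (1 + |t - T|)) ^ p * Real.exp (-(t - T) ^ 2) := by gcongr
    _ = (1 + |T|) ^ p * ((1 + |t - T|) ^ p * Real.exp (-(t - T) ^ 2)) := by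
        rw [Real.mul_rpow (by positivity) (by positivity)]; ring
    _ ≤ (1 + |T|) ^ p * (Real.exp (p * |t - T|) * Real.exp (-(t - T) ^ 2)) := by gcongr
    _ ≤ (1 + |T|) ^ p * Real.exp (p ^ 2) := by
        rw [← Real.exp_add]; gcongr
    _ = _ := mul_comm _ _

/-- **Convexity of the order of growth in a vertical strip.** A holomorphic function of at most
exponential growth in a strip, which has polynomial growth of orders `p` and `q` on the two edges,
has polynomial growth in the interior, with linearly interpolated order. -/
theorem exists_norm_le_interpolated_rpow {f : ℂ → ℂ} {l u p q A B C : ℝ} (hlu : l < u)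
    (hp : 0 ≤ p) (hq : 0 ≤ q)
    (hd : ∀ z : ℂ, l ≤ z.re → z.re ≤ u → DifferentiableAt ℂ f z)
    (hgrowth : ∀ z : ℂ, l ≤ z.re → z.re ≤ u → ‖f z‖ ≤ A * Real.exp (B * |z.im|))
    (hl : ∀ z : ℂ, z.re = l → ‖f z‖ ≤ C * (1 + |z.im|) ^ p)
    (hu : ∀ z : ℂ, z.re = u → ‖f z‖ ≤ C * (1 + |z.im|) ^ q) :
    ∃ D : ℝ, 0 < D ∧ ∀ z : ℂ, l ≤ z.re → z.re ≤ u →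
      ‖f z‖ ≤ D * (1 + |z.im|) ^ (((u - z.re) * p + (z.re - l) * q) / (u - l)) := by
  obtain ⟨K, hK, hKp⟩ := exists_rpow_mul_exp_neg_sq_le hp
  obtain ⟨K', hK', hKq⟩ := exists_rpow_mul_exp_neg_sq_le hq
  have hC : 0 ≤ C := by
    have := (norm_nonneg _).trans (hl l (by simp))
    simpa using this
  set E : ℝ := Real.exp (l ^ 2 + u ^ 2)
  set M : ℝ := (C + 1) * E * (K + K')
  have hM : 0 < M := by positivity
  have hul : 0 < u - l := sub_pos.2 hlu
  refine ⟨M, hM, fun z hz1 hz2 ↦ ?_⟩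
  set T := z.im
  set g : ℂ → ℂ := fun w ↦ f w * exp ((w - T * I) ^ 2)
  have hsq : ∀ x : ℝ, l ≤ x → x ≤ u → x ^ 2 ≤ l ^ 2 + u ^ 2 := fun x h1 h2 ↦ by
    rcases le_total 0 x with h | h <;> nlinarith [sq_nonneg l, sq_nonneg u]
  have hgd : DiffContOnCl ℂ g (HadamardThreeLines.verticalStrip l u) := by
    refine DifferentiableOn.diffContOnCl fun w hw ↦ ?_
    have hw' : w ∈ re ⁻¹' Set.Icc l u :=
      closure_minimal (Set.preimage_mono Set.Ioo_subset_Icc_self)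
        (isClosed_Icc.preimage continuous_re) hw
    have := hd w hw'.1 hw'.2
    exact (this.mul (by fun_prop)).differentiableWithinAt
  have hgB : BddAbove ((norm ∘ g) '' HadamardThreeLines.verticalClosedStrip l u) := by
    refine ⟨|A| * Real.exp (l ^ 2 + u ^ 2 + (|B| + |T|) ^ 2), ?_⟩
    rintro _ ⟨w, hw, rfl⟩
    have h1 := hgrowth w hw.1 hw.2
    have h2 := hsq w.re hw.1 hw.2
    simp only [Function.comp, g, norm_mul, norm_exp_sub_mul_I_sq]
    have h3 : A * Real.exp (B * |w.im|) ≤ |A| * Real.exp (|B| * |w.im|) := by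
      gcongr
      · exact le_abs_self A
      · exact le_abs_self B
    calc _ ≤ |A| * Real.exp (|B| * |w.im|) * Real.exp (w.re ^ 2 - (w.im - T) ^ 2) := by
          gcongr; exact h1.trans h3
      _ = |A| * Real.exp (|B| * |w.im| + (w.re ^ 2 - (w.im - T) ^ 2)) := by
          rw [Real.exp_add]; ring
      _ ≤ _ := by
        refine mul_le_mul_of_nonneg_left (Real.exp_le_exp.2 ?_) (abs_nonneg A)
        have h4 : |w.im| ≤ |w.im - T| + |T| := by
          simpa using abs_add_le (w.im - T) T
        rw [← sq_abs (w.im - T)]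
        nlinarith [abs_nonneg B, abs_nonneg T, abs_nonneg (w.im - T),
          mul_le_mul_of_nonneg_left h4 (abs_nonneg B), sq_nonneg (|B| - |w.im - T|),
          sq_nonneg (|B| + |T|), mul_nonneg (abs_nonneg B) (abs_nonneg T), sq_nonneg |B|]
  have hedge : ∀ (x r k : ℝ), 0 ≤ r → 0 < k → k ≤ K + K' → l ≤ x → x ≤ u →
      (∀ t T : ℝ, (1 + |t|) ^ r * Real.exp (-(t - T) ^ 2) ≤ k * (1 + |T|) ^ r) →
      (∀ w : ℂ, w.re = x → ‖f w‖ ≤ C * (1 + |w.im|) ^ r) →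
      ∀ w ∈ re ⁻¹' {x}, ‖g w‖ ≤ M * (1 + |T|) ^ r := by
    intro x r k hr hk hk' hx1 hx2 hkr hf w hw
    simp only [Set.mem_preimage, Set.mem_singleton_iff] at hw
    simp only [g, norm_mul, norm_exp_sub_mul_I_sq]
    calc _ ≤ C * (1 + |w.im|) ^ r * Real.exp (w.re ^ 2 - (w.im - T) ^ 2) := by
          gcongr; exact hf w hw
      _ = C * Real.exp (w.re ^ 2) * ((1 + |w.im|) ^ r * Real.exp (-(w.im - T) ^ 2)) := by
          rw [sub_eq_add_neg, Real.exp_add]; ring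
      _ ≤ (C + 1) * E * ((K + K') * (1 + |T|) ^ r) := by
          have h1 : C ≤ C + 1 := by linarith
          have h2 : Real.exp (w.re ^ 2) ≤ E := Real.exp_le_exp.2 (hw ▸ hsq x hx1 hx2)
          have h3 := (hkr w.im T).trans
            (mul_le_mul_of_nonneg_right hk' (by positivity : 0 ≤ (1 + |T|) ^ r))
          exact mul_le_mul (mul_le_mul h1 h2 (by positivity) (by positivity)) h3
            (by positivity) (by positivity)
      _ = _ := by ring
  have key := HadamardThreeLines.norm_le_interp_of_mem_verticalClosedStrip' hlu
    (show z ∈ HadamardThreeLines.verticalClosedStrip l u from ⟨hz1, hz2⟩) hgd hgB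
    (hedge l p K hp hK (by linarith) le_rfl hlu.le hKp hl)
    (hedge u q K' hq hK' (by linarith) hlu.le le_rfl hKq hu)
  have hfg : ‖f z‖ ≤ ‖g z‖ := by
    simp only [g, norm_mul, norm_exp_sub_mul_I_sq]
    refine le_mul_of_one_le_right (norm_nonneg _) (Real.one_le_exp ?_)
    simp only [T, sub_self]
    nlinarith [sq_nonneg z.re]
  refine hfg.trans (key.trans_eq ?_)
  have hT : 0 < 1 + |T| := by positivity
  rw [Real.mul_rpow hM.le (by positivity), Real.mul_rpow hM.le (by positivity),
    ← Real.rpow_mul hT.le, ← Real.rpow_mul hT.le, mul_mul_mul_comm, ← Real.rpow_add hM,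
    ← Real.rpow_add hT, sub_add_cancel, Real.rpow_one]
  congr 2
  field_simp
  ring

lemma Complex.norm_Gamma_le_Gamma_re {s : ℂ} (hs : 0 < s.re) : ‖Gamma s‖ ≤ Real.Gamma s.re := by
  rw [Gamma_eq_integral hs, GammaIntegral, Real.Gamma_eq_integral hs]
  refine (MeasureTheory.norm_integral_le_integral_norm _).trans_eq ?_
  refine MeasureTheory.setIntegral_congr_fun measurableSet_Ioi fun x hx ↦ ?_
  simp only [norm_mul, norm_real, norm_cpow_eq_rpow_re_of_pos hx, Real.norm_eq_abs,
    abs_of_pos (Real.exp_pos _), sub_re, one_re]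

lemma Complex.norm_sq_cos (z : ℂ) : ‖cos z‖ ^ 2 = Real.cos z.re ^ 2 + Real.sinh z.im ^ 2 := by
  rw [← re_add_im z, cos_add_mul_I, ← normSq_eq_norm_sq, normSq_apply]
  simp only [← ofReal_cos, ← ofReal_sin, ← ofReal_cosh, ← ofReal_sinh]
  simp [-ofReal_cos, -ofReal_sin, -ofReal_cosh, -ofReal_sinh]
  linear_combination Real.cos z.re ^ 2 * Real.cosh_sq z.im +
    Real.sinh z.im ^ 2 * Real.sin_sq_add_cos_sq z.re

lemma Complex.norm_sq_sin (z : ℂ) : ‖sin z‖ ^ 2 = Real.sin z.re ^ 2 + Real.sinh z.im ^ 2 := by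
  rw [← re_add_im z, sin_add_mul_I, ← normSq_eq_norm_sq, normSq_apply]
  simp only [← ofReal_cos, ← ofReal_sin, ← ofReal_cosh, ← ofReal_sinh]
  simp [-ofReal_cos, -ofReal_sin, -ofReal_cosh, -ofReal_sinh]
  linear_combination Real.sin z.re ^ 2 * Real.cosh_sq z.im +
    Real.sinh z.im ^ 2 * Real.sin_sq_add_cos_sq z.re

lemma Real.one_add_sinh_sq_le_exp (y : ℝ) : 1 + Real.sinh y ^ 2 ≤ Real.exp |y| ^ 2 := by
  have h := Real.cosh_sq y
  have h2 : Real.cosh y ≤ Real.exp |y| := by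
    rw [← Real.cosh_abs, Real.cosh_eq]
    linarith [Real.exp_le_exp.2 (show -|y| ≤ |y| by linarith [abs_nonneg y])]
  nlinarith [Real.cosh_pos y]

lemma Complex.norm_cos_le_exp (z : ℂ) : ‖cos z‖ ≤ Real.exp |z.im| := by
  refine le_of_sq_le_sq ?_ (Real.exp_pos _).le
  rw [norm_sq_cos]
  linarith [Real.cos_sq_le_one z.re, Real.one_add_sinh_sq_le_exp z.im]

lemma Complex.norm_sin_le_exp (z : ℂ) : ‖sin z‖ ≤ Real.exp |z.im| := by
  refine le_of_sq_le_sq ?_ (Real.exp_pos _).le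
  rw [norm_sq_sin]
  linarith [Real.sin_sq_le_one z.re, Real.one_add_sinh_sq_le_exp z.im]

lemma Complex.norm_sq_cos_pi_mul_half_integer (k : ℕ) (t : ℝ) :
    ‖cos (Real.pi * (1 / 2 + k + t * I) / 2)‖ ^ 2 = Real.cosh (Real.pi * t) / 2 := by
  have hre : (Real.pi * (1 / 2 + k + t * I) / 2 : ℂ).re = (Real.pi / 2 + k * Real.pi) / 2 := by
    have : (Real.pi * (1 / 2 + k + t * I) / 2 : ℂ)
      = ((Real.pi / 2 + k * Real.pi) / 2 : ℝ) + (Real.pi * t / 2 : ℝ) * I := by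
      push_cast; ring
    rw [this]; simp
  have him : (Real.pi * (1 / 2 + k + t * I) / 2 : ℂ).im = Real.pi * t / 2 := by
    have : (Real.pi * (1 / 2 + k + t * I) / 2 : ℂ)
      = ((Real.pi / 2 + k * Real.pi) / 2 : ℝ) + (Real.pi * t / 2 : ℝ) * I := by
      push_cast; ring
    rw [this]; simp
  rw [norm_sq_cos, hre, him, Real.cos_sq, mul_div_cancel₀ _ (two_ne_zero' ℝ),
    Real.cos_add_nat_mul_pi, Real.cos_pi_div_two]
  have h1 := Real.cosh_two_mul (Real.pi * t / 2)
  have h2 := Real.cosh_sq (Real.pi * t / 2)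
  rw [mul_div_cancel₀ _ (two_ne_zero' ℝ)] at h1
  rw [h1, h2]; ring

lemma Complex.norm_sq_Gamma_half_integer (k : ℕ) (t : ℝ) :
    ‖Gamma (1 / 2 + k + t * I)‖ ^ 2 =
      (∏ j ∈ Finset.range k, ‖(1 / 2 + j + t * I : ℂ)‖ ^ 2) *
        (Real.pi / Real.cosh (Real.pi * t)) := by
  induction k with
  | zero =>
    have h := Gamma_mul_Gamma_one_sub (1 / 2 + t * I)
    have h1 : (1 - (1 / 2 + t * I) : ℂ) = (starRingEnd ℂ) (1 / 2 + t * I) := by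
      simp [map_ofNat]; ring
    have h2 : sin (Real.pi * (1 / 2 + t * I)) = (Real.cosh (Real.pi * t) : ℝ) := by
      rw [show (Real.pi * (1 / 2 + t * I) : ℂ) = (Real.pi * t : ℝ) * I + Real.pi / 2 by
        push_cast; ring, sin_add_pi_div_two, cos_mul_I, ofReal_cosh]
    rw [h1, Gamma_conj, mul_conj, normSq_eq_norm_sq, h2] at h
    have h' : ‖Gamma (1 / 2 + t * I)‖ ^ 2 = Real.pi / Real.cosh (Real.pi * t) := mod_cast h
    simpa using h'
  | succ k ih =>
    have hne : (1 / 2 + k + t * I : ℂ) ≠ 0 := fun h ↦ by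
      have := congrArg re h
      simp at this
      have : (0 : ℝ) ≤ k := k.cast_nonneg
      linarith
    rw [show (1 / 2 + ((k + 1 : ℕ) : ℂ) + t * I) = (1 / 2 + k + t * I) + 1 by push_cast; ring,
      Gamma_add_one _ hne, norm_mul, mul_pow, ih, Finset.prod_range_succ]
    ring

/-- The factor in the functional equation `ζ (1 - s) = zetaFactor s * ζ s`. -/
noncomputable def zetaFactor (s : ℂ) : ℂ :=
  2 * (2 * Real.pi) ^ (-s) * Gamma s * cos (Real.pi * s / 2)

lemma norm_two_pi_cpow_neg (s : ℂ) :
    ‖(2 * Real.pi : ℂ) ^ (-s)‖ = (2 * Real.pi) ^ (-s.re) := by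
  have : (2 * Real.pi : ℂ) = ((2 * Real.pi : ℝ) : ℂ) := by push_cast; rfl
  rw [this, norm_cpow_eq_rpow_re_of_pos (by positivity), neg_re]

lemma norm_zetaFactor_half_integer (k : ℕ) (t : ℝ) :
    ‖zetaFactor (1 / 2 + k + t * I)‖ =
      (2 * Real.pi) ^ (-k : ℝ) * ∏ j ∈ Finset.range k, ‖(1 / 2 + j + t * I : ℂ)‖ := by
  have hc : 0 < Real.cosh (Real.pi * t) := Real.cosh_pos _
  have h : (‖Gamma (1 / 2 + k + t * I)‖ * ‖cos (Real.pi * (1 / 2 + k + t * I) / 2)‖) ^ 2 =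
      (Real.sqrt (Real.pi / 2) * ∏ j ∈ Finset.range k, ‖(1 / 2 + j + t * I : ℂ)‖) ^ 2 := by
    rw [mul_pow, mul_pow, Real.sq_sqrt (by positivity), norm_sq_Gamma_half_integer,
      norm_sq_cos_pi_mul_half_integer, Finset.prod_pow]
    field_simp
  have h' := (sq_eq_sq₀ (by positivity) (by positivity)).1 h
  rw [zetaFactor, norm_mul, norm_mul, norm_mul, mul_assoc _ ‖Gamma _‖, h', norm_two_pi_cpow_neg]
  have hre : (1 / 2 + k + t * I : ℂ).re = 1 / 2 + k := by simp
  rw [hre, neg_add, Real.rpow_add (by positivity), Real.rpow_neg (by positivity) (1 / 2),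
    ← Real.sqrt_eq_rpow]
  have h2 : 2 * (Real.sqrt (2 * Real.pi))⁻¹ * Real.sqrt (Real.pi / 2) = 1 := by
    rw [show 2 * Real.pi = 2 ^ 2 * (Real.pi / 2) by ring, Real.sqrt_mul (by positivity),
      Real.sqrt_sq (by positivity)]
    field_simp
  rw [norm_ofNat]
  linear_combination ((2 * Real.pi) ^ (-k : ℝ) *
    ∏ j ∈ Finset.range k, ‖(1 / 2 + j + t * I : ℂ)‖) * h2

lemma riemannZeta_one_sub_eq_zetaFactor_mul {s : ℂ} (hs : 1 < s.re) :
    riemannZeta (1 - s) = zetaFactor s * riemannZeta s := by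
  refine riemannZeta_one_sub (fun n h ↦ ?_) (fun h ↦ ?_)
  · have := congrArg re h
    simp at this
    have : (0 : ℝ) ≤ n := n.cast_nonneg
    linarith
  · simp [h] at hs

lemma eq_half_integer_add_im {s : ℂ} (k : ℕ) (hs : s.re = 1 / 2 + k) :
    s = 1 / 2 + k + s.im * I := by
  apply Complex.ext <;> simp [hs]

lemma differentiableAt_zetaFactor {s : ℂ} (hs : 0 < s.re) : DifferentiableAt ℂ zetaFactor s := by
  unfold zetaFactor
  have h1 : DifferentiableAt ℂ Gamma s := differentiableAt_Gamma s fun m h ↦ by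
    have := congrArg re h
    simp at this
    have : (0 : ℝ) ≤ m := m.cast_nonneg
    linarith
  have h2 : (2 * Real.pi : ℂ) ≠ 0 := by simp [Real.pi_ne_zero]
  have h3 : DifferentiableAt ℂ (fun s : ℂ ↦ (2 * Real.pi : ℂ) ^ (-s)) s :=
    (differentiableAt_id.neg).const_cpow (Or.inl h2)
  exact ((h3.const_mul 2).mul h1).mul (by fun_prop)

/-- In `1/2 ≤ Re s ≤ 7/2` the factor of the functional equation is `O((1 + |t|) ^ (σ - 1/2))`. -/
theorem exists_norm_zetaFactor_le :
    ∃ D : ℝ, 0 < D ∧ ∀ s : ℂ, 1 / 2 ≤ s.re → s.re ≤ 7 / 2 →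
      ‖zetaFactor s‖ ≤ D * (1 + |s.im|) ^ (s.re - 1 / 2) := by
  obtain ⟨A, hA⟩ : ∃ A, ∀ x ∈ Set.Icc (1 / 2 : ℝ) (7 / 2), Real.Gamma x ≤ A := by
    have hc : ContinuousOn Real.Gamma (Set.Icc (1 / 2 : ℝ) (7 / 2)) := fun x hx ↦
      (Real.differentiableOn_Gamma_Ioi.continuousOn.continuousAt
        (Ioi_mem_nhds (by linarith [hx.1]))).continuousWithinAt
    obtain ⟨A, hA⟩ := isCompact_Icc.bddAbove_image hc
    exact ⟨A, fun x hx ↦ hA ⟨x, hx, rfl⟩⟩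
  have h2pi : (1 : ℝ) ≤ 2 * Real.pi := by linarith [Real.pi_gt_three]
  have hgrowth (z : ℂ) (h1 : 1 / 2 ≤ z.re) (h2 : z.re ≤ 7 / 2) :
      ‖zetaFactor z‖ ≤ 2 * A * Real.exp (Real.pi / 2 * |z.im|) := by
    rw [zetaFactor, norm_mul, norm_mul, norm_mul, norm_two_pi_cpow_neg, norm_ofNat]
    have e1 : (2 * Real.pi) ^ (-z.re) ≤ 1 :=
      Real.rpow_le_one_of_one_le_of_nonpos h2pi (by linarith)
    have e2 : ‖Gamma z‖ ≤ A := (norm_Gamma_le_Gamma_re (by linarith)).trans (hA _ ⟨h1, h2⟩)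
    have e3 : ‖cos (Real.pi * z / 2)‖ ≤ Real.exp (Real.pi / 2 * |z.im|) := by
      refine (norm_cos_le_exp _).trans (Real.exp_le_exp.2 (le_of_eq ?_))
      have : (Real.pi * z / 2 : ℂ) = ((Real.pi / 2 : ℝ) : ℂ) * z := by push_cast; ring
      rw [this, im_ofReal_mul, abs_mul, abs_of_pos (by positivity)]
    have hA0 : 0 ≤ A := (norm_nonneg _).trans e2
    calc _ ≤ 2 * 1 * A * Real.exp (Real.pi / 2 * |z.im|) := by gcongr
      _ = _ := by ring
  have hl (z : ℂ) (hz : z.re = 1 / 2) : ‖zetaFactor z‖ ≤ 27 * (1 + |z.im|) ^ (0 : ℝ) := by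
    rw [eq_half_integer_add_im (s := z) 0 (by simpa using hz), norm_zetaFactor_half_integer]
    simp
  have hu (z : ℂ) (hz : z.re = 7 / 2) : ‖zetaFactor z‖ ≤ 27 * (1 + |z.im|) ^ (3 : ℝ) := by
    rw [eq_half_integer_add_im (s := z) 3 (by rw [hz]; norm_num), norm_zetaFactor_half_integer]
    have e1 : (2 * Real.pi) ^ (-(3 : ℕ) : ℝ) ≤ 1 :=
      Real.rpow_le_one_of_one_le_of_nonpos h2pi (by norm_num)
    have e2 : ∏ j ∈ Finset.range 3, ‖(1 / 2 + j + z.im * I : ℂ)‖ ≤ (3 * (1 + |z.im|)) ^ 3 := by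
      refine (Finset.prod_le_prod (fun _ _ ↦ norm_nonneg _) fun j hj ↦ ?_).trans_eq
        (by rw [Finset.prod_const, Finset.card_range])
      have hj' : (j : ℝ) ≤ 2 := by
        exact_mod_cast Nat.lt_succ_iff.1 (Finset.mem_range.1 hj)
      refine (norm_le_abs_re_add_abs_im _).trans ?_
      simp
      rw [abs_of_nonneg (by positivity)]
      linarith [abs_nonneg z.im]
    have him : (1 / 2 + (3 : ℕ) + z.im * I : ℂ).im = z.im := by simp
    rw [him]
    calc _ ≤ 1 * (3 * (1 + |z.im|)) ^ 3 := by gcongr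
      _ = _ := by
        rw [show (3 : ℝ) = ((3 : ℕ) : ℝ) by norm_num, Real.rpow_natCast]
        push_cast; ring
  obtain ⟨D, hD, h⟩ := exists_norm_le_interpolated_rpow (f := zetaFactor) (by norm_num) le_rfl
    (by norm_num) (fun z h _ ↦ differentiableAt_zetaFactor (by linarith)) hgrowth hl hu
  refine ⟨D, hD, fun s h1 h2 ↦ (h s h1 h2).trans_eq ?_⟩
  congr 2
  ring

lemma WeakFEPair.exists_norm_Λ₀_le (P : WeakFEPair ℂ) (l u : ℝ) :
    ∃ K : ℝ, ∀ s : ℂ, l ≤ s.re → s.re ≤ u → ‖P.Λ₀ s‖ ≤ K := by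
  have hint (σ : ℝ) : MeasureTheory.IntegrableOn
      (fun t : ℝ ↦ t ^ (σ - 1) * ‖P.f_modif t‖) (Set.Ioi 0) := by
    have h : MellinConvergent P.f_modif (σ : ℂ) :=
      mellinConvergent_of_isBigO_rpow P.hf_modif_int (a := σ + 1) (b := σ - 1)
        (P.isStrongFEPair_toStrongFEPair.hf_top _) (by simp)
        (P.isStrongFEPair_toStrongFEPair.hf_zero _) (by simp)
    refine (MeasureTheory.IntegrableOn.congr_fun h.norm (fun t ht ↦ ?_) measurableSet_Ioi)
    simp [norm_cpow_eq_rpow_re_of_pos (Set.mem_Ioi.1 ht)]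
  refine ⟨∫ t in Set.Ioi (0 : ℝ), (t ^ (l - 1) * ‖P.f_modif t‖ + t ^ (u - 1) * ‖P.f_modif t‖),
    fun s hl hu ↦ ?_⟩
  refine MeasureTheory.norm_integral_le_of_norm_le ((hint l).add (hint u)) ?_
  refine MeasureTheory.ae_restrict_of_forall_mem measurableSet_Ioi fun t ht ↦ ?_
  have ht : 0 < t := ht
  rw [norm_smul, norm_cpow_eq_rpow_re_of_pos ht, sub_re, one_re, ← add_mul]
  gcongr
  rcases le_total 1 t with h1 | h1
  · exact (Real.rpow_le_rpow_of_exponent_le h1 (by linarith)).trans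
      (le_add_of_nonneg_left (by positivity))
  · exact (Real.rpow_le_rpow_of_exponent_ge ht h1 (by linarith)).trans
      (le_add_of_nonneg_right (by positivity))

lemma exists_norm_completedRiemannZeta₀_le (l u : ℝ) :
    ∃ K : ℝ, ∀ s : ℂ, l ≤ s.re → s.re ≤ u → ‖completedRiemannZeta₀ s‖ ≤ K := by
  obtain ⟨K, hK⟩ := (HurwitzZeta.hurwitzEvenFEPair 0).exists_norm_Λ₀_le (l / 2) (u / 2)
  refine ⟨K / 2, fun s hl hu ↦ ?_⟩
  have h : completedRiemannZeta₀ s = (HurwitzZeta.hurwitzEvenFEPair 0).Λ₀ (s / 2) / 2 := rfl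
  rw [h, norm_div, norm_ofNat]
  gcongr
  exact hK _ (by simp; linarith) (by simp; linarith)

/-- The entire function `(s - 1) ζ(s)`. -/
noncomputable def subOneMulZeta (s : ℂ) : ℂ :=
  (s * (s - 1) * completedRiemannZeta₀ s + 1) *
    ((2 * (Real.pi : ℂ) ^ (-s / 2))⁻¹ * (Gamma (s / 2 + 1))⁻¹)

lemma subOneMulZeta_eq {s : ℂ} (hs : s ≠ 1) : subOneMulZeta s = (s - 1) * riemannZeta s := by
  have h : 1 - s ≠ 0 := sub_ne_zero.2 hs.symm
  rw [subOneMulZeta, riemannZeta_eq_mul_completedRiemannZeta₀]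
  field_simp
  ring

lemma differentiable_subOneMulZeta : Differentiable ℂ subOneMulZeta := by
  have h1 : Differentiable ℂ fun s : ℂ ↦ (Gamma (s / 2 + 1))⁻¹ :=
    differentiable_one_div_Gamma.comp (by fun_prop)
  have h2 : Differentiable ℂ fun s : ℂ ↦ (2 * (Real.pi : ℂ) ^ (-s / 2))⁻¹ := by
    have hpi : (Real.pi : ℂ) ≠ 0 := by simp [Real.pi_ne_zero]
    refine Differentiable.inv (fun s ↦ ?_) fun s ↦ by simp [hpi]
    exact (DifferentiableAt.const_cpow (by fun_prop) (Or.inl hpi)).const_mul 2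
  have h3 := differentiable_completedZeta₀
  unfold subOneMulZeta
  fun_prop

lemma norm_Gamma_inv_le (s : ℂ) (h0 : s.re < 1) :
    ‖(Gamma s)⁻¹‖ ≤ Real.Gamma (1 - s.re) * Real.exp (Real.pi * |s.im|) := by
  have h := Gamma_mul_Gamma_one_sub s
  have hG : Gamma (1 - s) ≠ 0 := Gamma_ne_zero_of_re_pos (by simp; linarith)
  by_cases hz : Gamma s = 0
  · have : 0 < Real.Gamma (1 - s.re) := Real.Gamma_pos_of_pos (by linarith)
    simp [hz]; positivity
  have hs : sin (Real.pi * s) ≠ 0 := fun h0 ↦ by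
    rw [h0, div_zero] at h
    exact (mul_ne_zero hz hG) h
  have e : (Gamma s)⁻¹ = Gamma (1 - s) * sin (Real.pi * s) / Real.pi := by
    have hpi : (Real.pi : ℂ) ≠ 0 := by simp [Real.pi_ne_zero]
    rw [eq_div_iff hs] at h
    rw [eq_div_iff hpi, inv_mul_eq_iff_eq_mul₀ hz]
    linear_combination -h
  rw [e, norm_div, norm_mul, norm_real, Real.norm_eq_abs, abs_of_pos Real.pi_pos]
  have h1 : ‖Gamma (1 - s)‖ ≤ Real.Gamma (1 - s.re) := by
    simpa using norm_Gamma_le_Gamma_re (s := 1 - s) (by simp; linarith)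
  have h2 : ‖sin (Real.pi * s)‖ ≤ Real.exp (Real.pi * |s.im|) := by
    refine (norm_sin_le_exp _).trans_eq ?_
    rw [im_ofReal_mul, abs_mul, abs_of_pos Real.pi_pos]
  refine (div_le_self (by positivity) (by linarith [Real.pi_gt_three])).trans ?_
  have : 0 < Real.Gamma (1 - s.re) := Real.Gamma_pos_of_pos (by linarith)
  gcongr

lemma exists_norm_subOneMulZeta_le_exp :
    ∃ A B : ℝ, ∀ s : ℂ, -(1 / 20) ≤ s.re → s.re ≤ 21 / 20 →
      ‖subOneMulZeta s‖ ≤ A * Real.exp (B * |s.im|) := by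
  obtain ⟨K, hK⟩ := exists_norm_completedRiemannZeta₀_le (-(1 / 20)) (21 / 20)
  obtain ⟨G, hG⟩ : ∃ G, ∀ x ∈ Set.Icc (1 / 4 : ℝ) 2, Real.Gamma x ≤ G := by
    have hc : ContinuousOn Real.Gamma (Set.Icc (1 / 4 : ℝ) 2) := fun x hx ↦
      (Real.differentiableOn_Gamma_Ioi.continuousOn.continuousAt
        (Ioi_mem_nhds (by linarith [hx.1]))).continuousWithinAt
    obtain ⟨A, hA⟩ := isCompact_Icc.bddAbove_image hc
    exact ⟨A, fun x hx ↦ hA ⟨x, hx, rfl⟩⟩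
  obtain ⟨M, hM⟩ : ∃ M, ∀ s ∈ Metric.closedBall (0 : ℂ) 3, ‖subOneMulZeta s‖ ≤ M :=
    (isCompact_closedBall _ _).exists_bound_of_continuousOn
      differentiable_subOneMulZeta.continuous.continuousOn
  have hG0 : 0 ≤ G := (Real.Gamma_pos_of_pos one_pos).le.trans (hG 1 (by norm_num))
  have hK0 : 0 ≤ K := (norm_nonneg _).trans (hK 0 (by norm_num) (by norm_num))
  have hM0 : 0 ≤ M := (norm_nonneg _).trans (hM 0 (by simp))
  have hpi := Real.pi_gt_three
  refine ⟨M + (4 * K + 1) * (Real.pi * (2 * G)), 2 + Real.pi / 2, fun s hl hu ↦ ?_⟩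
  rcases le_total |s.im| 1 with ht | ht
  · have h1 : ‖subOneMulZeta s‖ ≤ M := by
      refine hM s (mem_closedBall_zero_iff.2 ((norm_le_abs_re_add_abs_im s).trans ?_))
      have : |s.re| ≤ 2 := abs_le.2 ⟨by linarith, by linarith⟩
      linarith
    have h2 : 1 ≤ Real.exp ((2 + Real.pi / 2) * |s.im|) := Real.one_le_exp (by positivity)
    have h3 : 0 ≤ (4 * K + 1) * (Real.pi * (2 * G)) := by positivity
    nlinarith
  have hexp : 2 + |s.im| ≤ 2 * Real.exp |s.im| := by
    linarith [Real.add_one_le_exp |s.im|, abs_nonneg s.im]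
  have hn1 : ‖s‖ ≤ 2 * Real.exp |s.im| := by
    refine (norm_le_abs_re_add_abs_im s).trans (le_trans ?_ hexp)
    have : |s.re| ≤ 2 := abs_le.2 ⟨by linarith, by linarith⟩
    linarith
  have hn2 : ‖s - 1‖ ≤ 2 * Real.exp |s.im| := by
    refine (norm_le_abs_re_add_abs_im _).trans (le_trans ?_ hexp)
    have : |(s - 1).re| ≤ 2 := abs_le.2 ⟨by simp; linarith, by simp; linarith⟩
    simpa using this
  have e1 : ‖s * (s - 1) * completedRiemannZeta₀ s + 1‖ ≤ (4 * K + 1) * Real.exp (2 * |s.im|) := by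
    calc _ ≤ ‖s‖ * ‖s - 1‖ * ‖completedRiemannZeta₀ s‖ + 1 := by
          simpa using norm_add_le (s * (s - 1) * completedRiemannZeta₀ s) 1
      _ ≤ (2 * Real.exp |s.im|) * (2 * Real.exp |s.im|) * K + 1 := by gcongr; exact hK s hl hu
      _ = 4 * K * Real.exp (2 * |s.im|) + 1 := by rw [two_mul |s.im|, Real.exp_add]; ring
      _ ≤ _ := by linarith [Real.one_le_exp (show 0 ≤ 2 * |s.im| by positivity)]
  have e2 : ‖(2 * (Real.pi : ℂ) ^ (-s / 2))⁻¹‖ ≤ Real.pi := by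
    rw [norm_inv, norm_mul, norm_ofNat, norm_cpow_eq_rpow_re_of_pos Real.pi_pos, mul_inv,
      ← Real.rpow_neg Real.pi_pos.le]
    have : Real.pi ^ (-(-s / 2).re) ≤ Real.pi ^ (1 : ℝ) :=
      Real.rpow_le_rpow_of_exponent_le (by linarith) (by simp; linarith)
    rw [Real.rpow_one] at this
    linarith
  have e3 : ‖(Gamma (s / 2 + 1))⁻¹‖ ≤ 2 * G * Real.exp (Real.pi / 2 * |s.im|) := by
    have hs : s / 2 ≠ 0 := fun h ↦ by
      have h0 : s = 0 := by simpa using h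
      norm_num [h0] at ht
    have hn : 1 / 2 ≤ ‖s / 2‖ := by
      rw [norm_div, norm_ofNat]
      linarith [abs_im_le_norm s]
    have h1 : ‖(Gamma (s / 2))⁻¹‖ ≤ G * Real.exp (Real.pi / 2 * |s.im|) := by
      refine (norm_Gamma_inv_le (s / 2) (by simp; linarith)).trans ?_
      have him : Real.pi * |(s / 2).im| = Real.pi / 2 * |s.im| := by
        simp [abs_div]; ring
      rw [him]
      gcongr
      exact hG _ ⟨by simp; linarith, by simp; linarith⟩
    have h2 : ‖(s / 2)⁻¹‖ ≤ 2 := by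
      rw [norm_inv]
      exact inv_le_of_inv_le₀ (by norm_num) (by linarith)
    rw [Gamma_add_one _ hs, mul_inv, norm_mul]
    calc _ ≤ 2 * (G * Real.exp (Real.pi / 2 * |s.im|)) := by gcongr
      _ = _ := by ring
  rw [subOneMulZeta, norm_mul, norm_mul]
  calc _ ≤ (4 * K + 1) * Real.exp (2 * |s.im|) *
        (Real.pi * (2 * G * Real.exp (Real.pi / 2 * |s.im|))) := by gcongr
    _ = (4 * K + 1) * (Real.pi * (2 * G)) * Real.exp ((2 + Real.pi / 2) * |s.im|) := by
        rw [add_mul 2, Real.exp_add]; ring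
    _ ≤ _ := by gcongr; linarith

/-- In a half-plane `Re s ≥ x > 1`, the zeta function is bounded. -/
lemma exists_norm_riemannZeta_le {x : ℝ} (hx : 1 < x) :
    ∃ C : ℝ, 1 ≤ C ∧ ∀ s : ℂ, x ≤ s.re → ‖riemannZeta s‖ ≤ C := by
  refine ⟨max 1 (∑' n : ℕ, 1 / ((n : ℝ) + 1) ^ x), le_max_left _ _, fun s hs ↦ ?_⟩
  refine le_trans ?_ (le_max_right _ _)
  rw [zeta_eq_tsum_one_div_nat_add_one_cpow (by linarith)]
  have hsum : Summable fun n : ℕ ↦ 1 / ((n : ℝ) + 1) ^ x := by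
    simpa using (summable_nat_add_iff 1).2 (Real.summable_one_div_nat_rpow.2 hx)
  refine tsum_of_norm_bounded hsum.hasSum fun n ↦ ?_
  rw [norm_div, norm_one, show ((n : ℂ) + 1) = ((n + 1 : ℝ) : ℂ) by push_cast; rfl,
    norm_cpow_eq_rpow_re_of_pos (by positivity)]
  gcongr
  linarith [n.cast_nonneg (α := ℝ)]

lemma riemannZeta_eq_zetaFactor_one_sub_mul {s : ℂ} (hs : s.re < 0) :
    riemannZeta s = zetaFactor (1 - s) * riemannZeta (1 - s) := by
  rw [← riemannZeta_one_sub_eq_zetaFactor_mul (by simp; linarith), sub_sub_cancel]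

lemma exists_norm_riemannZeta_le_of_re_neg :
    ∃ C : ℝ, 0 < C ∧ ∀ s : ℂ, -(5 / 2) ≤ s.re → s.re ≤ -(1 / 20) →
      ‖riemannZeta s‖ ≤ C * (1 + |s.im|) ^ (1 / 2 - s.re) := by
  obtain ⟨D, hD, h⟩ := exists_norm_zetaFactor_le
  obtain ⟨C, hC, h'⟩ := exists_norm_riemannZeta_le (x := 21 / 20) (by norm_num)
  refine ⟨D * C, by positivity, fun s h1 h2 ↦ ?_⟩
  rw [riemannZeta_eq_zetaFactor_one_sub_mul (by linarith), norm_mul]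
  have e1 := h (1 - s) (by simp; linarith) (by simp; linarith)
  have e2 := h' (1 - s) (by simp; linarith)
  have e3 : (1 - s).re - 1 / 2 = 1 / 2 - s.re := by simp; ring
  have e4 : |(1 - s).im| = |s.im| := by simp
  rw [e3, e4] at e1
  calc _ ≤ D * (1 + |s.im|) ^ (1 / 2 - s.re) * C := by gcongr
    _ = _ := by ring

lemma exists_norm_riemannZeta_le_of_mem_strip :
    ∃ C : ℝ, 0 < C ∧ ∀ s : ℂ, -(1 / 20) ≤ s.re → s.re ≤ 21 / 20 → 1 ≤ |s.im| →
      ‖riemannZeta s‖ ≤ C * (1 + |s.im|) ^ ((21 / 20 - s.re) / 2) := by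
  obtain ⟨A, B, hAB⟩ := exists_norm_subOneMulZeta_le_exp
  obtain ⟨C₁, hC₁, h₁⟩ := exists_norm_riemannZeta_le (x := 21 / 20) (by norm_num)
  obtain ⟨C₂, hC₂, h₂⟩ := exists_norm_riemannZeta_le_of_re_neg
  have hsub (z : ℂ) (hz : |z.re - 1| ≤ 2) : ‖z - 1‖ ≤ 2 * (1 + |z.im|) := by
    refine (norm_le_abs_re_add_abs_im _).trans ?_
    simp only [sub_re, one_re, sub_im, one_im, sub_zero]
    linarith [abs_nonneg z.im]
  have hl (z : ℂ) (hz : z.re = -(1 / 20)) :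
      ‖subOneMulZeta z‖ ≤ (2 * C₁ + 2 * C₂) * (1 + |z.im|) ^ (31 / 20 : ℝ) := by
    rw [subOneMulZeta_eq (fun h ↦ by norm_num [h] at hz), norm_mul]
    have e1 := hsub z (by rw [hz]; norm_num [abs_le])
    have e2 := h₂ z (by rw [hz]; norm_num) hz.le
    rw [hz, show (1 / 2 - -(1 / 20) : ℝ) = 11 / 20 by norm_num] at e2
    calc _ ≤ 2 * (1 + |z.im|) * (C₂ * (1 + |z.im|) ^ (11 / 20 : ℝ)) := by gcongr
      _ = 2 * C₂ * (1 + |z.im|) ^ (31 / 20 : ℝ) := by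
        rw [show (31 / 20 : ℝ) = 1 + 11 / 20 by norm_num, Real.rpow_add (by positivity),
          Real.rpow_one]
        ring
      _ ≤ _ := by gcongr; linarith
  have hu (z : ℂ) (hz : z.re = 21 / 20) :
      ‖subOneMulZeta z‖ ≤ (2 * C₁ + 2 * C₂) * (1 + |z.im|) ^ (1 : ℝ) := by
    rw [subOneMulZeta_eq (fun h ↦ by norm_num [h] at hz), norm_mul, Real.rpow_one]
    have e1 := hsub z (by rw [hz]; norm_num [abs_le])
    have e2 := h₁ z hz.ge
    calc _ ≤ 2 * (1 + |z.im|) * C₁ := by gcongr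
      _ = 2 * C₁ * (1 + |z.im|) := by ring
      _ ≤ _ := by gcongr; linarith
  obtain ⟨D, hD, h⟩ := exists_norm_le_interpolated_rpow (by norm_num) (by norm_num)
    (by norm_num) (fun z _ _ ↦ differentiable_subOneMulZeta z) hAB hl hu
  refine ⟨2 * D, by positivity, fun s h1 h2 ht ↦ ?_⟩
  have h3 := h s h1 h2
  rw [subOneMulZeta_eq (fun h ↦ by norm_num [h] at ht), norm_mul,
    show ((21 / 20 - s.re) * (31 / 20) + (s.re - -(1 / 20)) * 1) / (21 / 20 - -(1 / 20)) =
      1 + (21 / 20 - s.re) / 2 by ring, Real.rpow_add (by positivity), Real.rpow_one] at h3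
  have h4 : (1 + |s.im|) / 2 ≤ ‖s - 1‖ := by
    have := abs_im_le_norm (s - 1)
    simp only [sub_im, one_im, sub_zero] at this
    linarith
  have h5 : (1 + |s.im|) / 2 * ‖riemannZeta s‖ ≤
      (1 + |s.im|) / 2 * (2 * D * (1 + |s.im|) ^ ((21 / 20 - s.re) / 2)) := by
    calc _ ≤ ‖s - 1‖ * ‖riemannZeta s‖ := by gcongr
      _ ≤ _ := h3
      _ = _ := by ring
  exact le_of_mul_le_mul_left h5 (by positivity)

/-- An admissible growth exponent for `ζ` on the line `Re s = σ`. -/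
noncomputable def zetaExponent (σ : ℝ) : ℝ := max 0 (max ((21 / 20 - σ) / 2) (1 / 2 - σ))

theorem exists_norm_riemannZeta_le_rpow :
    ∃ C : ℝ, 1 ≤ C ∧ ∀ s : ℂ, -(5 / 2) ≤ s.re → 1 ≤ |s.im| →
      ‖riemannZeta s‖ ≤ C * (1 + |s.im|) ^ zetaExponent s.re := by
  obtain ⟨C₁, hC₁, h₁⟩ := exists_norm_riemannZeta_le (x := 21 / 20) (by norm_num)
  obtain ⟨C₂, hC₂, h₂⟩ := exists_norm_riemannZeta_le_of_re_neg
  obtain ⟨C₃, hC₃, h₃⟩ := exists_norm_riemannZeta_le_of_mem_strip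
  refine ⟨C₁ + C₂ + C₃, by linarith, fun s hs ht ↦ ?_⟩
  have hmono {x : ℝ} (hx : x ≤ zetaExponent s.re) :
      (1 + |s.im|) ^ x ≤ (1 + |s.im|) ^ zetaExponent s.re :=
    Real.rpow_le_rpow_of_exponent_le (by linarith) hx
  rcases le_total (21 / 20) s.re with h | h
  · refine (h₁ s h).trans ?_
    have := hmono (le_max_left 0 _)
    rw [Real.rpow_zero] at this
    nlinarith
  rcases le_total (-(1 / 20)) s.re with h' | h'
  · refine (h₃ s h' h ht).trans ?_
    have := hmono ((le_max_left _ _).trans (le_max_right _ _))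
    gcongr
    linarith
  · refine (h₂ s hs h').trans ?_
    have := hmono ((le_max_right _ _).trans (le_max_right _ _))
    gcongr
    linarith

lemma exists_le_norm_riemannZeta {x : ℝ} (hx : 1 < x) :
    ∃ c : ℝ, 0 < c ∧ ∀ s : ℂ, x ≤ s.re → c ≤ ‖riemannZeta s‖ := by
  have hsum : Summable fun n : ℕ ↦ 1 / (n : ℝ) ^ x := Real.summable_one_div_nat_rpow.2 hx
  set M := ∑' n : ℕ, 1 / (n : ℝ) ^ x
  have hM : 0 ≤ M := tsum_nonneg fun n ↦ by positivity
  refine ⟨(M + 1)⁻¹, by positivity, fun s hs ↦ ?_⟩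
  have hs1 : 1 < s.re := by linarith
  have h := ArithmeticFunction.LSeries_zeta_mul_Lseries_moebius hs1
  rw [ArithmeticFunction.LSeries_zeta_eq_riemannZeta hs1] at h
  have hm : ‖LSeries (fun n ↦ (ArithmeticFunction.moebius n : ℂ)) s‖ ≤ M := by
    refine tsum_of_norm_bounded hsum.hasSum fun n ↦ ?_
    rw [LSeries.norm_term_eq]
    split_ifs with hn
    · positivity
    · have hn1 : (1 : ℝ) ≤ n := by exact_mod_cast Nat.one_le_iff_ne_zero.2 hn
      have : ‖(ArithmeticFunction.moebius n : ℂ)‖ ≤ 1 := by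
        rw [norm_intCast]
        exact_mod_cast ArithmeticFunction.abs_moebius_le_one
      gcongr
  have h' := congrArg norm h
  rw [norm_mul, norm_one] at h'
  rw [inv_le_iff_one_le_mul₀ (by positivity)]
  nlinarith [norm_nonneg (riemannZeta s)]

lemma exists_mul_abs_le_norm_riemannZeta :
    ∃ c : ℝ, 0 < c ∧ ∀ t : ℝ, c * |t| ≤ ‖riemannZeta (-(1 / 2) + t * I)‖ := by
  obtain ⟨c, hc, h⟩ := exists_le_norm_riemannZeta (x := 3 / 2) (by norm_num)
  refine ⟨(2 * Real.pi) ^ (-1 : ℝ) * c, by positivity, fun t ↦ ?_⟩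
  have e : (1 - (-(1 / 2) + t * I) : ℂ) = 1 / 2 + (1 : ℕ) + (-t : ℝ) * I := by
    push_cast; ring
  rw [riemannZeta_eq_zetaFactor_one_sub_mul (by norm_num), norm_mul, e,
    norm_zetaFactor_half_integer]
  have h1 := h (1 / 2 + (1 : ℕ) + (-t : ℝ) * I) (by norm_num)
  have h2 : |t| ≤ ‖(1 / 2 + (0 : ℕ) + (-t : ℝ) * I : ℂ)‖ := by
    simpa using abs_im_le_norm (1 / 2 + (0 : ℕ) + (-t : ℝ) * I : ℂ)
  rw [Finset.prod_range_one]
  calc _ = (2 * Real.pi) ^ (-1 : ℝ) * |t| * c := by ring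
    _ ≤ _ := by
      rw [Nat.cast_one]
      gcongr

lemma AnalyticOnNhd.one_le_divisor {f : ℂ → ℂ} {c u : ℂ} {R : ℝ} (hR : 0 < R)
    (hf : AnalyticOnNhd ℂ f (Metric.closedBall c R)) (hfc : f c ≠ 0)
    (hu : u ∈ Metric.closedBall c R) (hfu : f u = 0) :
    1 ≤ MeromorphicOn.divisor f (Metric.closedBall c R) u := by
  have hc : c ∈ Metric.closedBall c R := Metric.mem_closedBall_self hR.le
  have h1 : analyticOrderAt f c ≠ ⊤ := by
    rw [(hf c hc).analyticOrderAt_eq_zero.2 hfc]; simp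
  have h2 : analyticOrderAt f u ≠ ⊤ :=
    hf.analyticOrderAt_ne_top_of_isPreconnected (convex_closedBall c R).isPreconnected hc hu h1
  have h3 : analyticOrderAt f u ≠ 0 := fun h ↦ (hf u hu).analyticOrderAt_eq_zero.1 h hfu
  rw [MeromorphicOn.AnalyticOnNhd.divisor_apply hf hu]
  obtain ⟨n, hn⟩ := ENat.ne_top_iff_exists.1 h2
  rw [← hn] at h3 ⊢
  simp only [ne_eq, Nat.cast_eq_zero] at h3
  simp
  omega

/-- Jensen's inequality, with the zeros weighted by their distance to the boundary circle. -/
theorem AnalyticOnNhd.sum_max_log_le {f : ℂ → ℂ} {c : ℂ} {R : ℝ} (hR : 0 < R)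
    (hf : AnalyticOnNhd ℂ f (Metric.closedBall c R)) (hfc : f c ≠ 0) {g : ℝ → ℝ}
    (hg : Continuous g)
    (hle : ∀ θ, f (circleMap c R θ) ≠ 0 → Real.log ‖f (circleMap c R θ)‖ ≤ g θ)
    (S : Finset ℂ) (hS : ∀ ρ ∈ S, f ρ = 0) :
    ∑ ρ ∈ S, max 0 (Real.log (R / ‖ρ - c‖)) ≤
      (2 * Real.pi)⁻¹ * (∫ θ in 0..2 * Real.pi, g θ) - Real.log ‖f c‖ := by
  have habs : |R| = R := abs_of_pos hR
  set D := MeromorphicOn.divisor f (Metric.closedBall c R) with hD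
  have hfin : (D.support).Finite := D.finiteSupport (isCompact_closedBall c R)
  have hlog_nonneg {u : ℂ} (hu : u ∈ Metric.closedBall c R) (huc : u ≠ c) :
      0 ≤ Real.log (R * ‖c - u‖⁻¹) := by
    have h0 : 0 < ‖c - u‖ := norm_pos_iff.2 (sub_ne_zero.2 huc.symm)
    refine Real.log_nonneg ?_
    rw [← div_eq_mul_inv, one_le_div h0, norm_sub_rev]
    simpa [dist_eq_norm] using hu
  have hDc : D c = 0 := by
    rw [hD, MeromorphicOn.AnalyticOnNhd.divisor_apply hf (by simp [hR.le]),
      (hf c (by simp [hR.le])).analyticOrderAt_eq_zero.2 hfc]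
    simp
  have hD0 (u : ℂ) : 0 ≤ D u := MeromorphicOn.AnalyticOnNhd.divisor_nonneg hf u
  have hterm (u : ℂ) : 0 ≤ (D u : ℝ) * Real.log (R * ‖c - u‖⁻¹) := by
    by_cases hu : u ∈ Metric.closedBall c R
    · by_cases huc : u = c
      · simp [huc]
      · exact mul_nonneg (by exact_mod_cast hD0 u) (hlog_nonneg hu huc)
    · simp [hD, Function.locallyFinsuppWithin.apply_eq_zero_of_notMem _ hu]
  have jensen := AnalyticOnNhd.circleAverage_log_norm hR.ne' (by rwa [habs]) hfc
  rw [habs, ← hD] at jensen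
  have hsupp : (Function.support fun u ↦ (D u : ℝ) * Real.log (R * ‖c - u‖⁻¹)).Finite :=
    hfin.subset fun u hu h ↦ hu (by simp [h])
  have h1 : ∑ ρ ∈ S, max 0 (Real.log (R / ‖ρ - c‖)) ≤
      ∑ᶠ u, (D u : ℝ) * Real.log (R * ‖c - u‖⁻¹) := by
    classical
    rw [finsum_eq_sum_of_support_subset (s := hsupp.toFinset ∪ S) _ (fun u hu ↦ by
      simpa using Or.inl hu)]
    refine (Finset.sum_le_sum fun ρ hρ ↦ ?_).trans
      (Finset.sum_le_sum_of_subset_of_nonneg Finset.subset_union_right fun u _ _ ↦ hterm u)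
    refine max_le (hterm ρ) ?_
    rw [norm_sub_rev, div_eq_mul_inv]
    have hρc : ρ ≠ c := fun h ↦ hfc (h ▸ hS ρ hρ)
    by_cases hu : ρ ∈ Metric.closedBall c R
    · have h2 : (1 : ℝ) ≤ D ρ := by exact_mod_cast hf.one_le_divisor hR hfc hu (hS ρ hρ)
      exact le_mul_of_one_le_left (hlog_nonneg hu hρc) h2
    · refine le_trans (Real.log_nonpos (by positivity) ?_) (hterm ρ)
      have h0 : 0 < ‖c - ρ‖ := norm_pos_iff.2 (sub_ne_zero.2 hρc.symm)
      rw [← div_eq_mul_inv, div_le_one h0, norm_sub_rev]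
      rw [Metric.mem_closedBall, not_le, dist_eq_norm] at hu
      exact hu.le
  have hnull : ∀ᵐ θ : ℝ, f (circleMap c R θ) ≠ 0 := by
    have := (hfin.countable.preimage_circleMap c hR.ne').measure_zero MeasureTheory.volume
    filter_upwards [MeasureTheory.measure_eq_zero_iff_ae_notMem.1 this] with θ hθ h0
    refine hθ ?_
    have := hf.one_le_divisor hR hfc
      (Metric.sphere_subset_closedBall (circleMap_mem_sphere c hR.le θ)) h0
    exact fun h ↦ by rw [← hD] at this; omega
  have h2 : Real.circleAverage (Real.log ‖f ·‖) c R ≤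
      (2 * Real.pi)⁻¹ * ∫ θ in 0..2 * Real.pi, g θ := by
    rw [Real.circleAverage_def, smul_eq_mul]
    gcongr
    refine intervalIntegral.integral_mono_ae Real.two_pi_pos.le ?_ (hg.intervalIntegrable _ _) ?_
    · refine MeromorphicOn.circleIntegrable_log_norm (f := f) (hf.mono ?_).meromorphicOn
      rw [habs]
      exact Metric.sphere_subset_closedBall
    · filter_upwards [hnull] with θ hθ using hle θ hθ
  linarith

lemma analyticOnNhd_riemannZeta_sub (a : ℂ) {s : Set ℂ} (hs : (1 : ℂ) ∉ s) :
    AnalyticOnNhd ℂ (fun z ↦ riemannZeta z - a) s := by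
  have h : DifferentiableOn ℂ (fun z ↦ riemannZeta z - a) {1}ᶜ := fun z hz ↦
    ((differentiableAt_riemannZeta hz).sub_const a).differentiableWithinAt
  exact (h.analyticOnNhd isOpen_compl_singleton).mono fun z hz hz1 ↦ hs (hz1 ▸ hz)

lemma exists_norm_riemannZeta_sub_two_terms_le :
    ∃ K : ℝ, ∀ s : ℂ, 2 ≤ s.re →
      ‖riemannZeta s - (1 + 1 / 2 ^ s)‖ ≤ K * (1 / 3) ^ s.re := by
  have hsum2 : Summable fun n : ℕ ↦ 1 / ((n : ℝ) + 3) ^ (2 : ℝ) := by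
    simpa using (summable_nat_add_iff 3).2
      (Real.summable_one_div_nat_rpow.2 (one_lt_two (α := ℝ)))
  refine ⟨(∑' n : ℕ, 1 / ((n : ℝ) + 3) ^ (2 : ℝ)) * 9, fun s hs ↦ ?_⟩
  have hsum : Summable fun n : ℕ ↦ 1 / (n : ℂ) ^ s :=
    Complex.summable_one_div_nat_cpow.2 (by linarith)
  have hsplit := hsum.sum_add_tsum_nat_add 3
  rw [← zeta_eq_tsum_one_div_nat_cpow (by linarith)] at hsplit
  have hs0 : s ≠ 0 := fun h ↦ by norm_num [h] at hs
  have h3 : ∑ i ∈ Finset.range 3, 1 / (i : ℂ) ^ s = 1 + 1 / 2 ^ s := by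
    simp [Finset.sum_range_succ, hs0]
  rw [← hsplit, h3, add_sub_cancel_left]
  have hexp : (9 : ℝ) * (1 / 3) ^ s.re = (1 / 3) ^ (s.re - 2) := by
    rw [Real.rpow_sub (by norm_num)]
    norm_num
    ring
  rw [mul_assoc, hexp]
  refine tsum_of_norm_bounded (hsum2.hasSum.mul_right _) fun n ↦ ?_
  have hn : (0 : ℝ) < (n : ℝ) + 3 := by positivity
  rw [norm_div, norm_one, show (((n + 3 : ℕ) : ℂ)) = ((n + 3 : ℝ) : ℂ) by push_cast; rfl,
    norm_cpow_eq_rpow_re_of_pos hn, show s.re = 2 + (s.re - 2) by ring, Real.rpow_add hn,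
    one_div, mul_inv, ← one_div]
  gcongr
  rw [← Real.inv_rpow hn.le, show 2 + (s.re - 2) - 2 = s.re - 2 by ring]
  refine Real.rpow_le_rpow (by positivity) ?_ (by linarith)
  rw [inv_eq_one_div]
  gcongr
  linarith [n.cast_nonneg (α := ℝ)]

/-- Far to the right, `ζ(s) - a` is bounded away from zero on vertical lines. -/
theorem exists_half_mul_two_rpow_neg_le_norm_riemannZeta_sub (a : ℂ) :
    ∃ X : ℝ, 4 ≤ X ∧ ∀ s : ℂ, X ≤ s.re → 1 / 2 * (1 / 2) ^ s.re ≤ ‖riemannZeta s - a‖ := by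
  obtain ⟨K, hK⟩ := exists_norm_riemannZeta_sub_two_terms_le
  have ht1 : Filter.Tendsto (fun x : ℝ ↦ K * (2 / 3 : ℝ) ^ x) Filter.atTop (nhds (K * 0)) :=
    (tendsto_rpow_atTop_of_base_lt_one _ (by norm_num) (by norm_num)).const_mul K
  have ht2 : Filter.Tendsto (fun x : ℝ ↦ 2 * (1 / 2 : ℝ) ^ x) Filter.atTop (nhds (2 * 0)) :=
    (tendsto_rpow_atTop_of_base_lt_one _ (by norm_num) (by norm_num)).const_mul 2
  have h1 : ∀ᶠ x : ℝ in Filter.atTop, K * (2 / 3 : ℝ) ^ x ≤ 1 / 2 := by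
    filter_upwards [ht1.eventually_lt_const (show K * 0 < 1 / 2 by norm_num)] with x hx using hx.le
  have h2 : ∀ᶠ x : ℝ in Filter.atTop, a ≠ 1 → 2 * (1 / 2 : ℝ) ^ x ≤ ‖1 - a‖ := by
    by_cases ha : a = 1
    · simp [ha]
    · have hpos : 2 * 0 < ‖1 - a‖ := by
        simpa using sub_ne_zero.2 (Ne.symm ha)
      filter_upwards [ht2.eventually_lt_const hpos] with x hx _ using hx.le
  obtain ⟨X, hX⟩ := Filter.eventually_atTop.1 (h1.and h2)
  refine ⟨max X 4, le_max_right _ _, fun s hs ↦ ?_⟩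
  have hs4 : 4 ≤ s.re := (le_max_right _ _).trans hs
  obtain ⟨e1, e2⟩ := hX s.re ((le_max_left _ _).trans hs)
  have e3 := hK s (by linarith)
  have hpos : (0 : ℝ) < (1 / 2) ^ s.re := by positivity
  have e4 : K * (1 / 3 : ℝ) ^ s.re ≤ 1 / 2 * (1 / 2) ^ s.re := by
    have : (1 / 3 : ℝ) ^ s.re = (2 / 3) ^ s.re * (1 / 2) ^ s.re := by
      rw [← Real.mul_rpow (by norm_num) (by norm_num)]; norm_num
    rw [this, ← mul_assoc]
    gcongr
  have e5 : ‖(1 / 2 ^ s : ℂ)‖ = (1 / 2) ^ s.re := by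
    rw [norm_div, norm_one, show (2 : ℂ) = ((2 : ℝ) : ℂ) by norm_num,
      norm_cpow_eq_rpow_re_of_pos two_pos, Real.div_rpow (by norm_num) (by norm_num),
      Real.one_rpow]
  by_cases ha : a = 1
  · subst ha
    have := norm_sub_norm_le (1 / 2 ^ s : ℂ) (-(riemannZeta s - (1 + 1 / 2 ^ s)))
    rw [norm_neg, e5, show (1 / 2 ^ s - -(riemannZeta s - (1 + 1 / 2 ^ s)) : ℂ) =
      riemannZeta s - 1 by ring] at this
    linarith
  · have h3 := norm_sub_norm_le (1 - a) (-(1 / 2 ^ s + (riemannZeta s - (1 + 1 / 2 ^ s))))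
    have h4 := norm_add_le (1 / 2 ^ s : ℂ) (riemannZeta s - (1 + 1 / 2 ^ s))
    rw [norm_neg, show (1 - a - -(1 / 2 ^ s + (riemannZeta s - (1 + 1 / 2 ^ s))) : ℂ) =
      riemannZeta s - a by ring] at h3
    rw [e5] at h4
    linarith [e2 ha]

lemma circleMap_re (c : ℂ) (R θ : ℝ) : (circleMap c R θ).re = c.re + R * Real.cos θ := by
  simp [circleMap, exp_ofReal_mul_I_re]

lemma circleMap_im (c : ℂ) (R θ : ℝ) : (circleMap c R θ).im = c.im + R * Real.sin θ := by
  simp [circleMap, exp_ofReal_mul_I_im]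

lemma le_re_of_mem_closedBall {c z : ℂ} {R : ℝ} (hz : z ∈ Metric.closedBall c R) :
    c.re - R ≤ z.re := by
  have := (abs_re_le_norm (z - c)).trans (mem_closedBall_iff_norm.1 hz)
  rw [sub_re] at this
  linarith [(abs_le.1 this).1]

lemma log_norm_riemannZeta_sub_le {a : ℂ} {x C : ℝ}
    (h : ∀ s : ℂ, x ≤ s.re → ‖riemannZeta s‖ ≤ C) {s : ℂ} (hs : x ≤ s.re)
    (h0 : riemannZeta s - a ≠ 0) : Real.log ‖riemannZeta s - a‖ ≤ Real.log (C + ‖a‖) :=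
  Real.log_le_log (norm_pos_iff.2 h0) ((norm_sub_le _ _).trans (by linarith [h s hs]))

/-- The number of `a`-values in a box to the right of `Re s = 17/10` is bounded. -/
theorem exists_card_a_values_right_le (a : ℂ) :
    ∃ N : ℝ, ∀ (T : ℝ) (S : Finset ℂ), (∀ ρ ∈ S, riemannZeta ρ = a ∧ 17 / 10 < ρ.re ∧
      |ρ.im - T| ≤ 501 / 1000) → (S.card : ℝ) ≤ N := by
  obtain ⟨X, hX, hfar⟩ := exists_half_mul_two_rpow_neg_le_norm_riemannZeta_sub a
  obtain ⟨C, hC, hbd⟩ := exists_norm_riemannZeta_le (x := 6 / 5) (by norm_num)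
  have hl : 0 < Real.log ((X - 6 / 5) / (X - 8 / 5)) := by
    refine Real.log_pos ?_
    rw [one_lt_div (by linarith)]
    linarith
  set ℓ := Real.log ((X - 6 / 5) / (X - 8 / 5))
  refine ⟨(Real.log (C + ‖a‖) - Real.log (1 / 2 * (1 / 2) ^ X)) / ℓ, fun T S hS ↦ ?_⟩
  rw [le_div_iff₀ hl]
  have hre : (X + T * I : ℂ).re = X := by simp
  have him : (X + T * I : ℂ).im = T := by simp
  have hball {z : ℂ} (hz : z ∈ Metric.closedBall (X + T * I : ℂ) (X - 6 / 5)) : 6 / 5 ≤ z.re := by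
    have := le_re_of_mem_closedBall hz
    rw [hre] at this
    linarith
  have hc := hfar (X + T * I) (by rw [hre])
  rw [hre] at hc
  have hcpos : (0 : ℝ) < 1 / 2 * (1 / 2) ^ X := by positivity
  have hf0 : riemannZeta (X + T * I) - a ≠ 0 := norm_pos_iff.1 (hcpos.trans_le hc)
  have hR : 0 < X - 6 / 5 := by linarith
  have key := (analyticOnNhd_riemannZeta_sub a (s := Metric.closedBall (X + T * I) (X - 6 / 5))
    (fun h ↦ by have := hball h; norm_num at this)).sum_max_log_le hR hf0
    (g := fun _ ↦ Real.log (C + ‖a‖)) continuous_const (fun θ h0 ↦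
      log_norm_riemannZeta_sub_le hbd (hball (circleMap_mem_closedBall _ hR.le _)) h0)
    S (fun ρ hρ ↦ sub_eq_zero.2 (hS ρ hρ).1)
  rw [intervalIntegral.integral_const, smul_eq_mul, sub_zero, ← mul_assoc,
    inv_mul_cancel₀ (by positivity), one_mul] at key
  have hlow : ∀ ρ ∈ S, ℓ ≤ max 0 (Real.log ((X - 6 / 5) / ‖ρ - (X + T * I)‖)) := by
    intro ρ hρ
    obtain ⟨h1, h2, h3⟩ := hS ρ hρ
    have hρX : ρ.re < X := by
      by_contra! h
      have := hfar ρ h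
      rw [h1, sub_self, norm_zero] at this
      have : (0 : ℝ) < 1 / 2 * (1 / 2) ^ ρ.re := by positivity
      linarith
    have hne : 0 < ‖ρ - (X + T * I)‖ := by
      refine norm_pos_iff.2 (sub_ne_zero.2 fun h ↦ ?_)
      rw [h, hre] at hρX
      exact lt_irrefl _ hρX
    have hle : ‖ρ - (X + T * I)‖ ≤ X - 8 / 5 := by
      refine le_of_sq_le_sq ?_ (by linarith)
      rw [← normSq_eq_norm_sq, normSq_apply, sub_re, sub_im, hre, him]
      have := abs_le.1 h3
      nlinarith
    refine le_max_of_le_right (Real.log_le_log (div_pos hR (by linarith)) ?_)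
    gcongr
  have hsum := Finset.card_nsmul_le_sum S _ _ hlow
  rw [nsmul_eq_mul] at hsum
  have := Real.log_le_log hcpos hc
  linarith

/-- Near every point `3/2 + iT` of large height, `ζ - a` is not too small at some point. -/
theorem exists_near_rpow_neg_le_norm_riemannZeta_sub (a : ℂ) {η ε : ℝ} (hη : 0 < η) (hε : 0 < ε) :
    ∃ T₁ : ℝ, 1 ≤ T₁ ∧ ∀ T : ℝ, T₁ ≤ T → ∃ c : ℂ, ‖c - (3 / 2 + T * I)‖ < η ∧
      riemannZeta c - a ≠ 0 ∧ -(ε * Real.log T) ≤ Real.log ‖riemannZeta c - a‖ := by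
  obtain ⟨X, hX, hfar⟩ := exists_half_mul_two_rpow_neg_le_norm_riemannZeta_sub a
  obtain ⟨C, hC, hbd⟩ := exists_norm_riemannZeta_le (x := 3 / 2) (by norm_num)
  set r := X - 3 / 2 with hr
  have hr0 : 0 < r := by linarith
  set w : ℝ → ℝ := fun θ ↦ max 0 (1 - ‖circleMap 0 r θ + r‖ / η) with hw
  have hwc : Continuous w := by fun_prop
  have hw0 (θ : ℝ) : 0 ≤ w θ := le_max_left _ _
  have hw1 (θ : ℝ) : w θ ≤ 1 := max_le zero_le_one (sub_le_self _ (by positivity))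
  have hW : 0 < ∫ θ in 0..2 * Real.pi, w θ := by
    refine intervalIntegral.integral_pos Real.two_pi_pos hwc.continuousOn (fun θ _ ↦ hw0 θ)
      ⟨Real.pi, ⟨Real.pi_pos.le, by linarith [Real.pi_pos]⟩, ?_⟩
    simp [hw, circleMap]
  set W := (2 * Real.pi)⁻¹ * ∫ θ in 0..2 * Real.pi, w θ with hWdef
  have hWpos : 0 < W := by positivity
  set M := Real.log (C + ‖a‖) with hM
  have hM0 : 0 ≤ M := Real.log_nonneg (by linarith [norm_nonneg a])
  set B := (M - Real.log (1 / 2 * (1 / 2) ^ X)) / W with hB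
  refine ⟨max 1 (Real.exp (B / ε + 1)), le_max_left _ _, fun T hT ↦ ?_⟩
  have hT1 : 1 ≤ T := (le_max_left _ _).trans hT
  have hlogT : B / ε + 1 ≤ Real.log T := by
    rw [Real.le_log_iff_exp_le (by linarith)]
    exact (le_max_right _ _).trans hT
  by_contra! hcon
  set E := ε * Real.log T with hE
  have hE0 : 0 ≤ E := mul_nonneg hε.le (Real.log_nonneg hT1)
  have hre : (X + T * I : ℂ).re = X := by simp
  have hball {z : ℂ} (hz : z ∈ Metric.closedBall (X + T * I : ℂ) r) : 3 / 2 ≤ z.re := by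
    have := le_re_of_mem_closedBall hz
    rw [hre] at this
    linarith
  have hc := hfar (X + T * I) (by rw [hre])
  rw [hre] at hc
  have hcpos : (0 : ℝ) < 1 / 2 * (1 / 2) ^ X := by positivity
  have hf0 : riemannZeta (X + T * I) - a ≠ 0 := norm_pos_iff.1 (hcpos.trans_le hc)
  have key := (analyticOnNhd_riemannZeta_sub a (s := Metric.closedBall (X + T * I) r)
    (fun h ↦ by have := hball h; norm_num at this)).sum_max_log_le hr0 hf0
    (g := fun θ ↦ M - (E + M) * w θ) (by fun_prop) (fun θ h0 ↦ ?_) ∅ (by simp)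
  · rw [intervalIntegral.integral_sub (by simp) ((hwc.const_mul _).intervalIntegrable _ _),
      intervalIntegral.integral_const, intervalIntegral.integral_const_mul, smul_eq_mul, sub_zero,
      mul_sub, ← mul_assoc, inv_mul_cancel₀ (by positivity), one_mul, mul_left_comm,
      ← hWdef, Finset.sum_empty] at key
    have h1 := Real.log_le_log hcpos hc
    have h2 : (E + M) * W ≤ M - Real.log (1 / 2 * (1 / 2) ^ X) := by linarith
    rw [← le_div_iff₀ hWpos, ← hB] at h2
    have h3 : ε * (B / ε + 1) ≤ E := by rw [hE]; gcongr
    rw [mul_add, mul_div_cancel₀ _ hε.ne'] at h3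
    linarith
  · set z := circleMap (X + T * I) r θ with hz
    have hzM : Real.log ‖riemannZeta z - a‖ ≤ M :=
      log_norm_riemannZeta_sub_le hbd (hball (circleMap_mem_closedBall _ hr0.le _)) h0
    have hdist : z - (3 / 2 + T * I) = circleMap 0 r θ + r := by
      rw [hz, hr]
      simp [circleMap]
      ring
    by_cases hzη : ‖z - (3 / 2 + T * I)‖ < η
    · have := hcon z hzη h0
      nlinarith [hw0 θ, hw1 θ]
    · have : w θ = 0 := by
        rw [hw]
        refine max_eq_left (sub_nonpos.2 ?_)
        rw [one_le_div hη, ← hdist]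
        exact not_lt.1 hzη
      rw [this]
      linarith

lemma zetaExponent_le {σ y : ℝ} (h0 : 0 ≤ y) (h1 : (21 / 20 - σ) / 2 ≤ y) (h2 : 1 / 2 - σ ≤ y) :
    zetaExponent σ ≤ y := max_le h0 (max_le h1 h2)

lemma tangent_le_quartic (y₀ y : ℝ) : 4 * y₀ ^ 3 * y - 3 * y₀ ^ 4 ≤ y ^ 4 := by
  nlinarith [mul_nonneg (sq_nonneg (y - y₀)) (sq_nonneg (y + y₀)),
    mul_nonneg (sq_nonneg (y - y₀)) (sq_nonneg y₀)]

/-- A quartic majorant of the growth exponent on the circle of radius `17/10` about a point whose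
real part is close to `3/2`. -/
lemma zetaExponent_le_right {σ x : ℝ} (hσ : 1499 / 1000 ≤ σ) (hx : -1 ≤ x) :
    zetaExponent (σ + 17 / 10 * x) ≤ 23 / 500 * (1 - x) ^ 4 := by
  have h1 := tangent_le_quartic (5 / 3) (1 - x)
  have h2 := tangent_le_quartic 2 (1 - x)
  have h3 := tangent_le_quartic (33 / 20) (1 - x)
  refine zetaExponent_le (by positivity) ?_ ?_ <;> linarith

/-- The analogous majorant on the circle of radius `17/10` about a point with real part `-1/2`. -/
lemma zetaExponent_le_left {x : ℝ} (hx : x ≤ 1) :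
    zetaExponent (-(1 / 2) + 17 / 10 * x) ≤ 1 - 17 / 10 * x + 23 / 500 * (1 + x) ^ 4 := by
  have h1 := tangent_le_quartic (5 / 3) (1 + x)
  have h2 := tangent_le_quartic 2 (1 + x)
  have h3 : 0 ≤ (1 + x) ^ 4 := by positivity
  refine zetaExponent_le ?_ ?_ ?_ <;> linarith

lemma integral_cos_pow_quartic (u v w : ℝ) {ε : ℝ} (hε : ε ^ 2 = 1) :
    ∫ θ in 0..2 * Real.pi, (u + v * Real.cos θ + w * (1 + ε * Real.cos θ) ^ 4) =
      2 * Real.pi * (u + 35 / 8 * w) := by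
  have h (θ : ℝ) : HasDerivAt (fun θ ↦ u * θ + v * Real.sin θ + w * (35 / 8 * θ + 8 * ε * Real.sin θ
      + 27 / 8 * (Real.sin θ * Real.cos θ) - 4 / 3 * ε * Real.sin θ ^ 3
      + 1 / 4 * (Real.sin θ * Real.cos θ ^ 3)))
      (u + v * Real.cos θ + w * (1 + ε * Real.cos θ) ^ 4) θ := by
    have hs := Real.hasDerivAt_sin θ
    have hc := Real.hasDerivAt_cos θ
    have hid := hasDerivAt_id θ
    have hd := (((hid.const_mul u).add (hs.const_mul v)).add
      (((((hid.const_mul (35 / 8)).add (hs.const_mul (8 * ε))).add ((hs.mul hc).const_mul (27 / 8))).sub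
        ((hs.pow 3).const_mul (4 / 3 * ε))).add ((hs.mul (hc.pow 3)).const_mul (1 / 4)) |>.const_mul w))
    refine hd.congr_deriv ?_
    have hsq : Real.sin θ ^ 2 = 1 - Real.cos θ ^ 2 := Real.sin_sq θ
    have hε3 : ε ^ 3 = ε := by rw [pow_succ, hε, one_mul]
    have hε4 : ε ^ 4 = 1 := by rw [pow_succ, hε3, ← sq, hε]
    simp only [Pi.pow_apply]
    push_cast
    ring_nf
    rw [hsq, hε, hε3, hε4]
    ring
  rw [intervalIntegral.integral_eq_sub_of_hasDerivAt (fun θ _ ↦ h θ)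
    (Continuous.intervalIntegrable (by fun_prop) _ _)]
  simp
  ring

lemma exists_log_norm_riemannZeta_sub_le (a : ℂ) :
    ∃ C : ℝ, ∀ T : ℝ, 10 ≤ T → ∀ s : ℂ, -(5 / 2) ≤ s.re → |s.im - T| ≤ 2 →
      riemannZeta s - a ≠ 0 →
      Real.log ‖riemannZeta s - a‖ ≤ zetaExponent s.re * Real.log T + C := by
  obtain ⟨C, hC, h⟩ := exists_norm_riemannZeta_le_rpow
  refine ⟨Real.log (C + ‖a‖) + 3 * Real.log 2, fun T hT s hs him h0 ↦ ?_⟩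
  have him' := abs_le.1 him
  have hs0 : 0 ≤ s.im := by linarith
  have hμ0 : 0 ≤ zetaExponent s.re := le_max_left _ _
  have hμ3 : zetaExponent s.re ≤ 3 := zetaExponent_le (by norm_num) (by linarith) (by linarith)
  have hb := h s hs (by rw [abs_of_nonneg hs0]; linarith)
  rw [abs_of_nonneg hs0] at hb
  have h1 : (1 + s.im) ^ zetaExponent s.re ≤ (2 * T) ^ zetaExponent s.re :=
    Real.rpow_le_rpow (by linarith) (by linarith) hμ0
  have h2 : 1 ≤ (2 * T) ^ zetaExponent s.re := Real.one_le_rpow (by linarith) hμ0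
  have h3 : ‖riemannZeta s - a‖ ≤ (C + ‖a‖) * (2 * T) ^ zetaExponent s.re := by
    refine (norm_sub_le _ _).trans ?_
    have := norm_nonneg a
    nlinarith
  refine (Real.log_le_log (norm_pos_iff.2 h0) h3).trans ?_
  have hCa : 0 < C + ‖a‖ := by linarith [norm_nonneg a]
  rw [Real.log_mul hCa.ne' (by positivity), Real.log_rpow (by linarith),
    Real.log_mul two_ne_zero (by linarith)]
  nlinarith [Real.log_pos one_lt_two]

lemma exists_log_le_log_norm_riemannZeta_sub (a : ℂ) :
    ∃ C T₁ : ℝ, ∀ T : ℝ, T₁ ≤ T → riemannZeta (-(1 / 2) + T * I) - a ≠ 0 ∧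
      Real.log T - C ≤ Real.log ‖riemannZeta (-(1 / 2) + T * I) - a‖ := by
  obtain ⟨c, hc, h⟩ := exists_mul_abs_le_norm_riemannZeta
  refine ⟨-Real.log (c / 2), max 1 (2 * ‖a‖ / c), fun T hT ↦ ?_⟩
  have hT1 : 1 ≤ T := (le_max_left _ _).trans hT
  have hT2 : 2 * ‖a‖ ≤ T * c := (div_le_iff₀ hc).1 ((le_max_right _ _).trans hT)
  have h1 := h T
  rw [abs_of_pos (by linarith)] at h1
  have h2 : c / 2 * T ≤ ‖riemannZeta (-(1 / 2) + T * I) - a‖ := by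
    linarith [norm_sub_norm_le (riemannZeta (-(1 / 2) + T * I)) a]
  have hpos : 0 < c / 2 * T := by positivity
  refine ⟨norm_pos_iff.1 (hpos.trans_le h2), ?_⟩
  have := Real.log_le_log hpos h2
  rw [Real.log_mul (by positivity) (by positivity)] at this
  linarith

lemma norm_sub_mul_norm_sub_le {ρ c : ℂ} {T : ℝ} (h0 : 0 < ρ.re) (h1 : ρ.re ≤ 17 / 10)
    (him : |ρ.im - T| ≤ 501 / 1000) (hc : ‖c - (3 / 2 + T * I)‖ < 1 / 1000) :
    ‖ρ - c‖ * ‖ρ - (-(1 / 2) + T * I)‖ ≤ 63 / 50 := by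
  have hr1 : (3 / 2 + T * I : ℂ).re = 3 / 2 := by norm_num
  have hi1 : (3 / 2 + T * I : ℂ).im = T := by norm_num
  have hr2 : (-(1 / 2) + T * I : ℂ).re = -(1 / 2) := by norm_num
  have hi2 : (-(1 / 2) + T * I : ℂ).im = T := by norm_num
  have hsq : (ρ.im - T) ^ 2 ≤ (501 / 1000) ^ 2 := sq_le_sq' (abs_le.1 him).1 (abs_le.1 him).2
  have hh := sq_nonneg (ρ.im - T)
  have e1 : ‖ρ - (3 / 2 + T * I)‖ ^ 2 = (ρ.re - 3 / 2) ^ 2 + (ρ.im - T) ^ 2 := by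
    rw [← normSq_eq_norm_sq, normSq_apply, sub_re, sub_im, hr1, hi1]; ring
  have e2 : ‖ρ - (-(1 / 2) + T * I)‖ ^ 2 = (ρ.re + 1 / 2) ^ 2 + (ρ.im - T) ^ 2 := by
    rw [← normSq_eq_norm_sq, normSq_apply, sub_re, sub_im, hr2, hi2]; ring
  have p1 : ‖ρ - (3 / 2 + T * I)‖ * ‖ρ - (-(1 / 2) + T * I)‖ ≤ 1 + (501 / 1000) ^ 2 := by
    refine le_of_sq_le_sq ?_ (by positivity)
    rw [mul_pow, e1, e2]
    set h := (ρ.im - T) ^ 2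
    have hv : (ρ.re - 1 / 2) ^ 2 ≤ 2 - 2 * h := by nlinarith
    calc _ = (ρ.re - 1 / 2) ^ 2 * ((ρ.re - 1 / 2) ^ 2 - (2 - 2 * h)) + (1 + h) ^ 2 := by ring
      _ ≤ (1 + h) ^ 2 := by nlinarith [sq_nonneg (ρ.re - 1 / 2)]
      _ ≤ _ := by gcongr
  have p2 : ‖ρ - (-(1 / 2) + T * I)‖ ≤ 3 := by
    refine le_of_sq_le_sq ?_ (by norm_num)
    rw [e2]
    nlinarith
  have p3 : ‖ρ - c‖ ≤ ‖ρ - (3 / 2 + T * I)‖ + 1 / 1000 := by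
    have := norm_sub_le (ρ - (3 / 2 + T * I)) (c - (3 / 2 + T * I))
    rw [sub_sub_sub_cancel_right] at this
    linarith
  nlinarith [norm_nonneg (ρ - (-(1 / 2) + T * I))]

lemma le_max_log_add_max_log {d₁ d₂ : ℝ} (h₁ : 0 < d₁) (h₂ : 0 < d₂) (h : d₁ * d₂ ≤ 63 / 50) :
    819 / 1000 ≤ max 0 (Real.log (17 / 10 / d₁)) + max 0 (Real.log (17 / 10 / d₂)) := by
  have e1 : 289 / 126 ≤ 17 / 10 / d₁ * (17 / 10 / d₂) := by
    rw [div_mul_div_comm, le_div_iff₀ (by positivity)]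
    linarith
  have e2 := Real.log_le_log (by norm_num) e1
  rw [Real.log_mul (by positivity) (by positivity), show (289 / 126 : ℝ) = 2 * (289 / 252) by
    norm_num, Real.log_mul (by norm_num) (by norm_num)] at e2
  have e3 := Real.one_sub_inv_le_log_of_pos (show (0 : ℝ) < 289 / 252 by norm_num)
  have e4 := Real.log_two_gt_d9
  have e5 := le_max_right 0 (Real.log (17 / 10 / d₁))
  have e6 := le_max_right 0 (Real.log (17 / 10 / d₂))
  norm_num at e3 e4
  linarith

lemma exists_card_a_values_box_le (a : ℂ) :
    ∃ C T₁ : ℝ, ∀ T : ℝ, T₁ ≤ T → ∀ S : Finset ℂ,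
      (∀ ρ ∈ S, riemannZeta ρ = a ∧ 0 < ρ.re ∧ ρ.re ≤ 17 / 10 ∧ |ρ.im - T| ≤ 501 / 1000) →
      819 / 1000 * (S.card : ℝ) ≤ 4035 / 10000 * Real.log T + C := by
  obtain ⟨C, hC⟩ := exists_log_norm_riemannZeta_sub_le a
  obtain ⟨D, T₂, hD⟩ := exists_log_le_log_norm_riemannZeta_sub a
  obtain ⟨T₃, -, hT₃⟩ := exists_near_rpow_neg_le_norm_riemannZeta_sub a
    (η := 1 / 1000) (ε := 1 / 1000) (by norm_num) (by norm_num)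
  refine ⟨2 * C + D, max 10 (max T₂ T₃), fun T hT S hS ↦ ?_⟩
  obtain ⟨hT10, hT⟩ := max_le_iff.1 hT
  obtain ⟨hT2, hT3⟩ := max_le_iff.1 hT
  obtain ⟨c, hc, hc0, hclog⟩ := hT₃ T hT3
  obtain ⟨hl0, hllog⟩ := hD T hT2
  have hlog : 0 ≤ Real.log T := Real.log_nonneg (by linarith)
  have hcre := (abs_re_le_norm (c - (3 / 2 + T * I))).trans_lt hc
  have hcim := (abs_im_le_norm (c - (3 / 2 + T * I))).trans_lt hc
  norm_num [abs_lt] at hcre hcim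
  have hre : (-(1 / 2) + T * I : ℂ).re = -(1 / 2) := by norm_num
  have him : (-(1 / 2) + T * I : ℂ).im = T := by norm_num
  have hana {d : ℂ} (hd : 5 ≤ d.im) : AnalyticOnNhd ℂ (fun z ↦ riemannZeta z - a)
      (Metric.closedBall d (17 / 10)) := by
    refine analyticOnNhd_riemannZeta_sub a fun h1 ↦ ?_
    have := (abs_im_le_norm (1 - d)).trans (mem_closedBall_iff_norm.1 h1)
    norm_num [abs_le] at this
    linarith
  have right := (hana (d := c) (by linarith)).sum_max_log_le (by norm_num) hc0
    (g := fun θ ↦ C + 0 * Real.cos θ +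
      23 / 500 * Real.log T * (1 + (-1) * Real.cos θ) ^ 4) (by fun_prop) (fun θ h0 ↦ by
      have h1 := Real.neg_one_le_cos θ
      have h2 := Real.cos_le_one θ
      have h3 := Real.neg_one_le_sin θ
      have h4 := Real.sin_le_one θ
      have := hC T hT10 (circleMap c (17 / 10) θ) (by rw [circleMap_re]; linarith)
        (by rw [circleMap_im, abs_le]; constructor <;> linarith) h0
      rw [circleMap_re] at this
      have h5 := mul_le_mul_of_nonneg_right
        (zetaExponent_le_right (σ := c.re) (by linarith) h1) hlog
      linarith) S (fun ρ hρ ↦ sub_eq_zero.2 (hS ρ hρ).1)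
  have left := (hana (d := -(1 / 2) + T * I) (by rw [him]; linarith)).sum_max_log_le
    (by norm_num) hl0
    (g := fun θ ↦ (Real.log T + C) + -(17 / 10 * Real.log T) * Real.cos θ +
      23 / 500 * Real.log T * (1 + 1 * Real.cos θ) ^ 4) (by fun_prop) (fun θ h0 ↦ by
      have h1 := Real.neg_one_le_cos θ
      have h2 := Real.cos_le_one θ
      have h3 := Real.neg_one_le_sin θ
      have h4 := Real.sin_le_one θ
      have := hC T hT10 (circleMap (-(1 / 2) + T * I) (17 / 10) θ)
        (by rw [circleMap_re, hre]; linarith)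
        (by rw [circleMap_im, him, abs_le]; constructor <;> linarith) h0
      rw [circleMap_re, hre] at this
      have h5 := mul_le_mul_of_nonneg_right (zetaExponent_le_left h2) hlog
      linarith) S (fun ρ hρ ↦ sub_eq_zero.2 (hS ρ hρ).1)
  rw [integral_cos_pow_quartic _ _ _ (by norm_num), inv_mul_cancel_left₀ (by positivity)]
    at left right
  have hsum := S.card_nsmul_le_sum (fun ρ ↦ max 0 (Real.log (17 / 10 / ‖ρ - c‖)) +
    max 0 (Real.log (17 / 10 / ‖ρ - (-(1 / 2) + T * I)‖))) (819 / 1000) fun ρ hρ ↦ by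
      obtain ⟨hρa, hρ0, hρ1, hρT⟩ := hS ρ hρ
      refine le_max_log_add_max_log ?_ ?_ (norm_sub_mul_norm_sub_le hρ0 hρ1 hρT hc)
      · refine norm_pos_iff.2 (sub_ne_zero.2 ?_)
        rintro rfl
        exact hc0 (sub_eq_zero.2 hρa)
      · refine norm_pos_iff.2 (sub_ne_zero.2 ?_)
        rintro rfl
        exact hl0 (sub_eq_zero.2 hρa)
  rw [Finset.sum_add_distrib, nsmul_eq_mul] at hsum
  linarith

/-- For any fixed complex number `a` and every sufficiently large `T₀` there is a
`T ∈ [T₀, T₀ + 1)` such that `|T − γ_a| ≥ 1/log T` for every nontrivial `a`-value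
`ρ_a = β_a + iγ_a` of the Riemann zeta function (nontrivial meaning `β_a > 0`). -/
theorem exists_height_distant_from_a_values (a : ℂ) :
    ∃ T₁ : ℝ, 0 < T₁ ∧ ∀ T₀ : ℝ, T₁ ≤ T₀ → ∃ T : ℝ, T₀ ≤ T ∧ T < T₀ + 1 ∧
      ∀ ρ : ℂ, 0 < ρ.re → riemannZeta ρ = a → 1 / Real.log T ≤ |T - ρ.im| := by
  obtain ⟨C, T₂, hbox⟩ := exists_card_a_values_box_le a
  obtain ⟨N, hN⟩ := exists_card_a_values_right_le a
  set M : ℝ := max 1000 ((819 / 1000 * (1 + N) + 4035 / 10000 + C) / (6 / 1000)) with hM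
  refine ⟨max (Real.exp M + 1) T₂, by positivity, fun T₀ hT₀ ↦ ?_⟩
  obtain ⟨hTM, hT₂⟩ := max_le_iff.1 hT₀
  have hT1 : 1 ≤ T₀ := by linarith [Real.exp_pos M]
  have hL : M < Real.log T₀ := (Real.lt_log_iff_exp_lt (by linarith)).2 (by linarith)
  set L := Real.log T₀
  obtain ⟨hL1, hL2⟩ := max_lt_iff.1 hL
  rw [div_lt_iff₀ (by norm_num)] at hL2
  have hL0 : 0 < L := by linarith
  have hL' : 1 / L ≤ 1 / 1000 := one_div_le_one_div_of_le (by norm_num) hL1.le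
  by_contra! hcon
  set n := ⌊L / 2⌋₊
  have hn : (n : ℝ) ≤ L / 2 := Nat.floor_le (by positivity)
  have hn' : L / 2 < n + 1 := Nat.lt_floor_add_one _
  let t : Fin n → ℝ := fun j ↦ T₀ + 2 * j / L
  have ht0 (j : Fin n) : T₀ ≤ t j := le_add_of_nonneg_right (by positivity)
  have ht1 (j : Fin n) : t j < T₀ + 1 := by
    have : (j : ℝ) < n := by exact_mod_cast j.2
    refine (add_lt_add_iff_left _).2 ((div_lt_one hL0).2 (by linarith))
  choose ρ hρ0 hρa hρt using fun j ↦ hcon (t j) (ht0 j) (ht1 j)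
  have hclose (j : Fin n) : |t j - (ρ j).im| < 1 / L :=
    (hρt j).trans_le (one_div_le_one_div_of_le hL0 (Real.log_le_log (by linarith) (ht0 j)))
  have hsep {i j : Fin n} (hij : i < j) : ρ i ≠ ρ j := by
    intro h
    have h1 := abs_lt.1 (hclose i)
    have h2 := abs_lt.1 (hclose j)
    rw [h] at h1
    have h3 : (i : ℝ) + 1 ≤ j := by exact_mod_cast hij
    have h4 : t i + 2 * (1 / L) ≤ t j := by
      have : 2 * ((i : ℝ) + 1) / L ≤ 2 * j / L := by gcongr
      calc t i + 2 * (1 / L) = T₀ + 2 * ((i : ℝ) + 1) / L := by simp only [t]; ring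
        _ ≤ _ := by simpa only [t, add_le_add_iff_left] using this
    linarith [h1.2, h2.1, h1.1, h2.2]
  have hinj : Function.Injective ρ := by
    intro i j h
    rcases lt_trichotomy i j with hij | hij | hij
    · exact absurd h (hsep hij)
    · exact hij
    · exact absurd h.symm (hsep hij)
  set S : Finset ℂ := Finset.univ.image ρ
  have hcard : S.card = n := by
    rw [Finset.card_image_of_injective _ hinj, Finset.card_univ, Fintype.card_fin]
  have hS : ∀ z ∈ S, riemannZeta z = a ∧ 0 < z.re ∧ |z.im - (T₀ + 1 / 2)| ≤ 501 / 1000 := by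
    intro z hz
    obtain ⟨j, -, rfl⟩ := Finset.mem_image.1 hz
    refine ⟨hρa j, hρ0 j, ?_⟩
    have h1 := abs_lt.1 (hclose j)
    have h2 := ht0 j
    have h3 := ht1 j
    rw [abs_le]
    constructor <;> linarith
  have hsplit := S.card_filter_add_card_filter_not (fun z : ℂ ↦ z.re ≤ 17 / 10)
  have hleft := hbox (T₀ + 1 / 2) (by linarith) (S.filter fun z ↦ z.re ≤ 17 / 10) fun z hz ↦ by
    obtain ⟨hz, hre⟩ := Finset.mem_filter.1 hz
    exact ⟨(hS z hz).1, (hS z hz).2.1, hre, (hS z hz).2.2⟩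
  have hright := hN (T₀ + 1 / 2) (S.filter fun z ↦ ¬ z.re ≤ 17 / 10) fun z hz ↦ by
    obtain ⟨hz, hre⟩ := Finset.mem_filter.1 hz
    exact ⟨(hS z hz).1, not_le.1 hre, (hS z hz).2.2⟩
  have hlog : Real.log (T₀ + 1 / 2) ≤ L + 1 := by
    have h1 : Real.log (T₀ + 1 / 2) ≤ Real.log (T₀ * 2) :=
      Real.log_le_log (by linarith) (by linarith)
    rw [Real.log_mul (by linarith) two_ne_zero] at h1
    linarith [Real.log_two_lt_d9]
  rw [hcard] at hsplit
  have hsplit' : ((S.filter fun z ↦ z.re ≤ 17 / 10).card : ℝ) +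
      (S.filter fun z ↦ ¬ z.re ≤ 17 / 10).card = n := by exact_mod_cast hsplit
  linarith
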